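/- Let F : ℝ → ℝ satisfy: (A1) F(1) = 0; (A2) for all x, y > 0, F(x·y) + F(x/y) = 2·F(x)·F(y) + 2·F(x) + 2·F(y); and (A3) the limit as t → 0 (t ≠ 0) of 2·F(exp t)/t² equals 1. Then for all x > 0, F(x) = (1/2)·(x + x⁻¹) − 1. -/

import Mathlib

open Filter Topology

/-- A quantity that does not increase under doubling near `0` and tends to `0` at `0` is
nonpositive near `0`. -/
theorem eventually_nonpos_of_le_half {Q : ℝ → ℝ}
    (hle : ∀ᶠ u in 𝓝[≠] (0 : ℝ), Q (2 * u) ≤ Q u) (hQ : Tendsto Q (𝓝[≠] 0) (𝓝 0)) :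
    ∀ᶠ t in 𝓝[≠] (0 : ℝ), Q t ≤ 0 := by
  rw [eventually_nhdsWithin_iff, Metric.eventually_nhds_iff] at hle ⊢
  obtain ⟨δ, hδ, hle⟩ := hle
  refine ⟨δ, hδ, fun t ht ht0 => ?_⟩
  have ht0' : t ≠ 0 := ht0
  have hmem (n : ℕ) : t / 2 ^ n ≠ 0 := by positivity
  have hstep (n : ℕ) : Q t ≤ Q (t / 2 ^ n) := by
    induction n with
    | zero => simp
    | succ n ih =>
      refine ih.trans ?_
      have hdist : dist (t / 2 ^ (n + 1)) 0 < δ := by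
        rw [dist_zero_right] at ht ⊢
        rw [norm_div, norm_pow, Real.norm_two]
        exact (div_le_self (norm_nonneg t) (one_le_pow₀ one_le_two)).trans_lt ht
      have h := hle hdist (hmem (n + 1))
      rwa [show 2 * (t / 2 ^ (n + 1)) = t / 2 ^ n by field_simp; ring] at h
  have hlim : Tendsto (fun n : ℕ => t / 2 ^ n) atTop (𝓝[≠] 0) :=
    tendsto_nhdsWithin_iff.2
      ⟨tendsto_const_nhds.div_atTop (tendsto_pow_atTop_atTop_of_one_lt one_lt_two),
        Eventually.of_forall hmem⟩
  exact ge_of_tendsto' (hQ.comp hlim) hstep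

/-- Two solutions of the duplication formula for `cosh - 1` which have the same quadratic
calibration at `0` agree away from `0`. -/
theorem eq_of_duplication {f g : ℝ → ℝ}
    (hf : ∀ u, f (2 * u) = 2 * f u ^ 2 + 4 * f u) (hg : ∀ u, g (2 * u) = 2 * g u ^ 2 + 4 * g u)
    (hf₂ : Tendsto (fun t => 2 * f t / t ^ 2) (𝓝[≠] 0) (𝓝 1))
    (hg₂ : Tendsto (fun t => 2 * g t / t ^ 2) (𝓝[≠] 0) (𝓝 1)) {t : ℝ} (ht : t ≠ 0) :
    f t = g t := by
  have hsum : ∀ᶠ u in 𝓝[≠] (0 : ℝ), |f u + g u| ≤ 2 * u ^ 2 := by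
    have h := (hf₂.add hg₂).abs.eventually_lt_const (show |(1 : ℝ) + 1| < 4 by norm_num)
    filter_upwards [h, self_mem_nhdsWithin] with u hu hu0
    have hu0' : u ≠ 0 := hu0
    have hpos : 0 < u ^ 2 := by positivity
    rw [← add_div, ← mul_add, abs_div, abs_of_pos hpos, div_lt_iff₀ hpos, abs_mul,
      abs_two] at hu
    linarith
  have hlim : Tendsto (fun u => |f u - g u| / u ^ 2 * Real.exp (-u ^ 2 / 3))
      (𝓝[≠] 0) (𝓝 0) := by
    have hexp : Tendsto (fun u : ℝ => Real.exp (-u ^ 2 / 3)) (𝓝[≠] 0) (𝓝 1) := by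
      have hc : Continuous fun u : ℝ => Real.exp (-u ^ 2 / 3) := by fun_prop
      simpa using (hc.tendsto 0).mono_left nhdsWithin_le_nhds
    have h := ((hf₂.sub hg₂).abs.div_const 2).mul hexp
    simp only [sub_self, abs_zero, zero_div, zero_mul] at h
    refine h.congr fun u => ?_
    rw [← sub_div, ← mul_sub, abs_div, abs_mul, abs_two, abs_of_nonneg (sq_nonneg u)]
    ring
  have hle : ∀ᶠ u in 𝓝[≠] (0 : ℝ),
      |f (2 * u) - g (2 * u)| / (2 * u) ^ 2 * Real.exp (-(2 * u) ^ 2 / 3)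
        ≤ |f u - g u| / u ^ 2 * Real.exp (-u ^ 2 / 3) := by
    filter_upwards [hsum] with u hu
    have hfac : |f (2 * u) - g (2 * u)| ≤ |f u - g u| * (4 * Real.exp (u ^ 2)) := by
      rw [hf, hg, show 2 * f u ^ 2 + 4 * f u - (2 * g u ^ 2 + 4 * g u)
        = (f u - g u) * (2 * (f u + g u) + 4) by ring, abs_mul]
      refine mul_le_mul_of_nonneg_left ?_ (abs_nonneg _)
      have hexp := Real.add_one_le_exp (u ^ 2)
      rw [abs_le] at hu ⊢
      constructor <;> linarith [hu.1, hu.2]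
    calc _ ≤ |f u - g u| * (4 * Real.exp (u ^ 2)) / (2 * u) ^ 2
          * Real.exp (-(2 * u) ^ 2 / 3) := by gcongr
      _ = |f u - g u| / u ^ 2 * (Real.exp (u ^ 2) * Real.exp (-(2 * u) ^ 2 / 3)) := by
        rw [mul_pow]
        field_simp
        ring
      _ = _ := by
        rw [← Real.exp_add]
        congr 2
        ring
  have heq : ∀ᶠ u in 𝓝[≠] (0 : ℝ), f u = g u := by
    filter_upwards [eventually_nonpos_of_le_half hle hlim, self_mem_nhdsWithin] with u hu hu0
    have hu0' : u ≠ 0 := hu0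
    have h := nonpos_of_mul_nonpos_left hu (Real.exp_pos _)
    rw [div_le_iff₀ (by positivity), zero_mul] at h
    exact sub_eq_zero.1 (abs_nonpos_iff.1 h)
  have hseq : Tendsto (fun n : ℕ => t / 2 ^ n) atTop (𝓝[≠] 0) :=
    tendsto_nhdsWithin_iff.2
      ⟨tendsto_const_nhds.div_atTop (tendsto_pow_atTop_atTop_of_one_lt one_lt_two),
        Eventually.of_forall fun n => show t / 2 ^ n ≠ 0 by positivity⟩
  obtain ⟨n, hn⟩ := (hseq.eventually heq).exists
  have hdouble (m : ℕ) (u : ℝ) (h : f u = g u) : f (2 ^ m * u) = g (2 ^ m * u) := by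
    induction m with
    | zero => simpa using h
    | succ m ih => rw [pow_succ', mul_assoc, hf, hg, ih]
  have h := hdouble n _ hn
  rwa [mul_div_cancel₀ t (by positivity)] at h

theorem cosh_sub_one_two_mul (u : ℝ) :
    Real.cosh (2 * u) - 1 = 2 * (Real.cosh u - 1) ^ 2 + 4 * (Real.cosh u - 1) := by
  rw [Real.cosh_two_mul, Real.sinh_sq]
  ring

theorem tendsto_cosh_sub_one_div_sq :
    Tendsto (fun t : ℝ => 2 * (Real.cosh t - 1) / t ^ 2) (𝓝[≠] 0) (𝓝 1) := by
  have hd : HasDerivAt (fun t : ℝ => 2 * Real.sinh (t / 2)) 1 0 := by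
    simpa using (((hasDerivAt_id (0 : ℝ)).div_const 2).sinh.const_mul 2)
  have h := hd.tendsto_slope_zero.pow 2
  simp only [one_pow] at h
  refine h.congr fun t => ?_
  have hc : Real.cosh t = Real.cosh (t / 2) ^ 2 + Real.sinh (t / 2) ^ 2 := by
    rw [← Real.cosh_two_mul, mul_div_cancel₀ t two_ne_zero]
  rw [hc, Real.cosh_sq]
  simp only [zero_add, zero_div, Real.sinh_zero, mul_zero, sub_zero, smul_eq_mul]
  ring

/-- **T5 (Cost Uniqueness).** A function satisfying normalization (A1), the
multiplicative d'Alembert composition law (A2), and quadratic calibration at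
unity (A3) is the canonical reciprocal cost `J x = (1/2)(x + x⁻¹) - 1`. -/
theorem cost_uniqueness (F : ℝ → ℝ)
    (hA1 : F 1 = 0)
    (hA2 : ∀ x y : ℝ, 0 < x → 0 < y →
      F (x * y) + F (x / y) = 2 * F x * F y + 2 * F x + 2 * F y)
    (hA3 : Tendsto (fun t : ℝ => 2 * F (Real.exp t) / t ^ 2) (𝓝[≠] 0) (𝓝 1)) :
    ∀ x : ℝ, 0 < x → F x = (1 / 2) * (x + x⁻¹) - 1 := by
  intro x hx
  rcases eq_or_ne x 1 with rfl | hx1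
  · norm_num [hA1]
  have hdup (u : ℝ) : F (Real.exp (2 * u)) = 2 * F (Real.exp u) ^ 2 + 4 * F (Real.exp u) := by
    have h := hA2 _ _ (Real.exp_pos u) (Real.exp_pos u)
    rw [div_self (Real.exp_ne_zero u), hA1, ← Real.exp_add, ← two_mul] at h
    linarith
  have h := eq_of_duplication (f := fun t => F (Real.exp t)) (g := fun t => Real.cosh t - 1)
    hdup cosh_sub_one_two_mul hA3 tendsto_cosh_sub_one_div_sq
    (Real.log_ne_zero_of_pos_of_ne_one hx hx1)
  simp only [Real.exp_log hx, Real.cosh_log hx] at h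
  rw [h]
  ring
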